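/- Suppose the linear operators 𝒜₁,…,𝒜ₛ : ℝ^{n×n} → ℝ^m satisfy the ARIP at rank 3r with parameter δ₃ᵣ, where γ₁ := 4δ₃ᵣ/(1−δ₃ᵣ) < 1. Let X₁,…,Xₛ ∈ ℝ^{n×n} have rank at most r, let y = Σ_{k=1}^s 𝒜_k(X_k), and for each k let X_{k,l} ∈ ℝ^{n×n} have rank exactly r. Define r_l = y − Σ_{k=1}^s 𝒜_k(X_{k,l}), G_{k,l} = 𝒜_k^*(r_l), and assume P_{T_{k,l}}(G_{k,l}) ≠ 0 where T_{k,l} is the tangent space at X_{k,l}; set α_{k,l} = ‖P_{T_{k,l}}(G_{k,l})‖_F² / ‖𝒜_k(P_{T_{k,l}}(G_{k,l}))‖², and let X_{k,l+1} be a best rank-r approximation of X_{k,l} + α_{k,l} G_{k,l}. Then √(Σ_{k=1}^s ‖X_{k,l+1} − X_k‖_F²) ≤ γ₁ · √(Σ_{k=1}^s ‖X_{k,l} − X_k‖_F²). -/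

import Mathlib

open Matrix MeasureTheory ProbabilityTheory Finset

noncomputable section

/-- Frobenius inner product on square real matrices: `⟨X,Y⟩ = trace (Xᵀ Y)`. -/
def finner {n : ℕ} (X Y : Matrix (Fin n) (Fin n) ℝ) : ℝ := (Xᵀ * Y).trace

/-- Frobenius norm. -/
def fnorm {n : ℕ} (X : Matrix (Fin n) (Fin n) ℝ) : ℝ := Real.sqrt (finner X X)

/-- Euclidean norm on `ℝ^m`. -/
def enorm2 {m : ℕ} (v : Fin m → ℝ) : ℝ := Real.sqrt (∑ p, (v p) ^ 2)

/-- The linear operator `𝒜` associated with measurement matrices `A_p`: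
`(𝒜 Z)_p = (1/√m) ⟨A_p, Z⟩`. -/
def opA {n m : ℕ} (A : Fin m → Matrix (Fin n) (Fin n) ℝ)
    (Z : Matrix (Fin n) (Fin n) ℝ) : Fin m → ℝ :=
  fun p => (1 / Real.sqrt m) * finner (A p) Z

/-- The adjoint operator `𝒜^* v = (1/√m) Σ_p v_p A_p`. -/
def adjA {n m : ℕ} (A : Fin m → Matrix (Fin n) (Fin n) ℝ)
    (v : Fin m → ℝ) : Matrix (Fin n) (Fin n) ℝ :=
  (1 / Real.sqrt m) • ∑ p, v p • A p

/-- Amalgam restricted isometry property at rank `r` with parameter `δ`. -/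
def ARIP {n m s : ℕ} (𝒜 : Fin s → Matrix (Fin n) (Fin n) ℝ → (Fin m → ℝ))
    (r : ℕ) (δ : ℝ) : Prop :=
  ∀ Z : Fin s → Matrix (Fin n) (Fin n) ℝ, (∀ k, (Z k).rank ≤ r) →
    (1 - δ) * ∑ k, fnorm (Z k) ^ 2 ≤ enorm2 (∑ k, 𝒜 k (Z k)) ^ 2 ∧
    enorm2 (∑ k, 𝒜 k (Z k)) ^ 2 ≤ (1 + δ) * ∑ k, fnorm (Z k) ^ 2

/-- Orthogonal projection onto the tangent space determined by the SVD factors `U`, `V`: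
`P_T(G) = UUᵀG + GVVᵀ − UUᵀGVVᵀ`. -/
def Pt {n r : ℕ} (U V : Matrix (Fin n) (Fin r) ℝ)
    (G : Matrix (Fin n) (Fin n) ℝ) : Matrix (Fin n) (Fin n) ℝ :=
  U * Uᵀ * G + G * (V * Vᵀ) - U * Uᵀ * G * (V * Vᵀ)

/-- `X'` is a best rank-`r` approximation of `W` in Frobenius norm. -/
def IsBestRankApprox {n : ℕ} (r : ℕ) (W X' : Matrix (Fin n) (Fin n) ℝ) : Prop :=
  X'.rank ≤ r ∧ ∀ Z : Matrix (Fin n) (Fin n) ℝ, Z.rank ≤ r → fnorm (X' - W) ≤ fnorm (Z - W)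

section helpers

lemma finner_add_left' {n : ℕ} (X Y Z : Matrix (Fin n) (Fin n) ℝ) :
    finner (X + Y) Z = finner X Z + finner Y Z := by
  simp [finner, Matrix.add_mul]

lemma finner_add_right' {n : ℕ} (X Y Z : Matrix (Fin n) (Fin n) ℝ) :
    finner X (Y + Z) = finner X Y + finner X Z := by
  simp [finner, Matrix.mul_add]

lemma finner_smul_left' {n : ℕ} (c : ℝ) (X Y : Matrix (Fin n) (Fin n) ℝ) :
    finner (c • X) Y = c * finner X Y := by
  simp [finner]

lemma finner_smul_right' {n : ℕ} (c : ℝ) (X Y : Matrix (Fin n) (Fin n) ℝ) :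
    finner X (c • Y) = c * finner X Y := by
  simp [finner]

lemma finner_comm' {n : ℕ} (X Y : Matrix (Fin n) (Fin n) ℝ) :
    finner X Y = finner Y X := by
  unfold finner
  rw [← Matrix.trace_transpose]
  simp [Matrix.transpose_mul]

lemma finner_eq_sum {n : ℕ} (X Y : Matrix (Fin n) (Fin n) ℝ) :
    finner X Y = ∑ j, ∑ i, X i j * Y i j := by
  simp [finner, Matrix.trace, Matrix.mul_apply]

lemma finner_self_nonneg {n : ℕ} (X : Matrix (Fin n) (Fin n) ℝ) : 0 ≤ finner X X := by
  rw [finner_eq_sum]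
  exact Finset.sum_nonneg fun j _ => Finset.sum_nonneg fun i _ => mul_self_nonneg _

lemma finner_self_pos {n : ℕ} (X : Matrix (Fin n) (Fin n) ℝ) (h : X ≠ 0) : 0 < finner X X := by
  refine lt_of_le_of_ne (finner_self_nonneg X) fun h0 => h ?_
  rw [finner_eq_sum] at h0
  ext i j
  have h1 := (Finset.sum_eq_zero_iff_of_nonneg
    (fun j _ => Finset.sum_nonneg fun i _ => mul_self_nonneg (X i j))).1 h0.symm j (Finset.mem_univ _)
  have h2 := (Finset.sum_eq_zero_iff_of_nonneg
    (fun i _ => mul_self_nonneg (X i j))).1 h1 i (Finset.mem_univ _)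
  simpa using h2

lemma fnorm_sq {n : ℕ} (X : Matrix (Fin n) (Fin n) ℝ) : fnorm X ^ 2 = finner X X :=
  Real.sq_sqrt (finner_self_nonneg X)

lemma enorm2_sq {m : ℕ} (v : Fin m → ℝ) : enorm2 v ^ 2 = v ⬝ᵥ v := by
  unfold enorm2
  rw [Real.sq_sqrt (Finset.sum_nonneg fun p _ => sq_nonneg _)]
  simp [dotProduct, sq]

lemma quad_bound {a b c : ℝ} (ha : 0 ≤ a) (hc : 0 ≤ c)
    (h : ∀ t : ℝ, 0 ≤ a * t ^ 2 - 2 * b * t + c) : b ^ 2 ≤ a * c := by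
  have := discrim_le_zero (a := a) (b := -2 * b) (c := c) (fun t => by nlinarith [h t])
  unfold discrim at this
  nlinarith

lemma finner_cs {n : ℕ} (X Y : Matrix (Fin n) (Fin n) ℝ) :
    |finner X Y| ≤ fnorm X * fnorm Y := by
  refine abs_le_of_sq_le_sq ?_ (mul_nonneg (Real.sqrt_nonneg _) (Real.sqrt_nonneg _))
  rw [mul_pow, fnorm_sq, fnorm_sq]
  apply quad_bound (finner_self_nonneg _) (finner_self_nonneg _)
  intro t
  have := finner_self_nonneg (t • X + (-1 : ℝ) • Y)
  simp only [finner_add_left', finner_add_right', finner_smul_left', finner_smul_right',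
    finner_comm' Y X] at this
  nlinarith

lemma opA_add {n m : ℕ} (A : Fin m → Matrix (Fin n) (Fin n) ℝ) (X Y) :
    opA A (X + Y) = opA A X + opA A Y := by
  ext p; simp [opA, finner_add_right', mul_add]

lemma opA_smul {n m : ℕ} (A : Fin m → Matrix (Fin n) (Fin n) ℝ) (c : ℝ) (X) :
    opA A (c • X) = c • opA A X := by
  ext p; simp [opA, finner_smul_right']; ring

lemma opA_zero {n m : ℕ} (A : Fin m → Matrix (Fin n) (Fin n) ℝ) :
    opA A 0 = 0 := by
  ext p; simp [opA, finner]

lemma finner_sum_right {n : ℕ} {ι : Type*} (s : Finset ι) (X : Matrix (Fin n) (Fin n) ℝ)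
    (f : ι → Matrix (Fin n) (Fin n) ℝ) :
    finner X (∑ i ∈ s, f i) = ∑ i ∈ s, finner X (f i) := by
  simp [finner, Matrix.mul_sum, Matrix.trace_sum]

lemma finner_adjA {n m : ℕ} (A : Fin m → Matrix (Fin n) (Fin n) ℝ) (D) (v : Fin m → ℝ) :
    finner D (adjA A v) = opA A D ⬝ᵥ v := by
  simp only [adjA, finner_smul_right', finner_sum_right, dotProduct, opA, Finset.mul_sum]
  refine Finset.sum_congr rfl fun p _ => ?_
  rw [finner_comm' D]; ring

lemma mrank_add_le {n : ℕ} (X Y : Matrix (Fin n) (Fin n) ℝ) :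
    (X + Y).rank ≤ X.rank + Y.rank := by
  unfold Matrix.rank
  rw [Matrix.mulVecLin_add]
  refine (Submodule.finrank_mono (LinearMap.range_add_le _ _)).trans ?_
  exact Submodule.finrank_add_le_finrank_add_finrank _ _

lemma rank_smul_le' {n : ℕ} (c : ℝ) (X : Matrix (Fin n) (Fin n) ℝ) : (c • X).rank ≤ X.rank := by
  have : c • X = (c • (1 : Matrix (Fin n) (Fin n) ℝ)) * X := by simp
  rw [this]; exact Matrix.rank_mul_le_right _ _

lemma rank_Pt {n r : ℕ} (U V : Matrix (Fin n) (Fin r) ℝ) (G : Matrix (Fin n) (Fin n) ℝ) :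
    (Pt U V G).rank ≤ 3 * r := by
  have h : Pt U V G = U * (Uᵀ * G) + (G - U * Uᵀ * G) * V * Vᵀ := by
    unfold Pt
    simp only [Matrix.sub_mul, Matrix.mul_assoc]
    abel
  rw [h]
  have h1 : (U * (Uᵀ * G)).rank ≤ r :=
    (Matrix.rank_mul_le_left _ _).trans ((Matrix.rank_le_card_width U).trans (by simp))
  have h2 : ((G - U * Uᵀ * G) * V * Vᵀ).rank ≤ r :=
    (Matrix.rank_mul_le_left _ _).trans ((Matrix.rank_le_card_width _).trans (by simp))
  have := mrank_add_le (U * (Uᵀ * G)) ((G - U * Uᵀ * G) * V * Vᵀ)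
  omega

lemma arip_single {n m s R : ℕ} (A : Fin s → Fin m → Matrix (Fin n) (Fin n) ℝ) (δ : ℝ)
    (h : ARIP (fun k => opA (A k)) R δ) (k : Fin s) (P : Matrix (Fin n) (Fin n) ℝ)
    (hP : P.rank ≤ R) :
    (1 - δ) * fnorm P ^ 2 ≤ enorm2 (opA (A k) P) ^ 2 ∧
      enorm2 (opA (A k) P) ^ 2 ≤ (1 + δ) * fnorm P ^ 2 := by
  have := h (Pi.single k P) (fun j => by
    by_cases hj : j = k
    · subst hj; simpa using hP
    · simp [hj])
  have e1 : ∑ j, fnorm ((Pi.single k P : Fin s → Matrix (Fin n) (Fin n) ℝ) j) ^ 2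
      = fnorm P ^ 2 := by
    rw [Finset.sum_eq_single k]
    · simp
    · intro j _ hj; simp [hj, fnorm, finner]
    · simp
  have e2 : ∑ j, opA (A j) ((Pi.single k P : Fin s → Matrix (Fin n) (Fin n) ℝ) j)
      = opA (A k) P := by
    rw [Finset.sum_eq_single k]
    · simp
    · intro j _ hj; simp [hj, opA_zero]
    · simp
  simpa only [e1, e2] using this

lemma arip_polar {n m s R : ℕ} (A : Fin s → Fin m → Matrix (Fin n) (Fin n) ℝ) (δ : ℝ)
    (hδ : 0 ≤ δ)
    (h : ARIP (fun k => opA (A k)) R δ) (D E : Fin s → Matrix (Fin n) (Fin n) ℝ)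
    (hr : ∀ (t u : ℝ) k, (t • D k + u • E k).rank ≤ R) :
    |∑ k, finner (D k) (E k) - (∑ k, opA (A k) (D k)) ⬝ᵥ (∑ k, opA (A k) (E k))| ≤
      δ * (√(∑ k, fnorm (D k) ^ 2) * √(∑ k, fnorm (E k) ^ 2)) := by
  have hD : 0 ≤ ∑ k, fnorm (D k) ^ 2 := Finset.sum_nonneg fun _ _ => sq_nonneg _
  have hE : 0 ≤ ∑ k, fnorm (E k) ^ 2 := Finset.sum_nonneg fun _ _ => sq_nonneg _
  refine abs_le_of_sq_le_sq ?_ (by positivity)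
  rw [mul_pow, mul_pow, Real.sq_sqrt hD, Real.sq_sqrt hE]
  suffices H : (∑ k, finner (D k) (E k) -
      (∑ k, opA (A k) (D k)) ⬝ᵥ (∑ k, opA (A k) (E k))) ^ 2 ≤
      (δ * ∑ k, fnorm (D k) ^ 2) * (δ * ∑ k, fnorm (E k) ^ 2) by linarith
  apply quad_bound (by positivity) (by positivity)
  intro t
  have key : ∀ t u : ℝ, ∑ k, fnorm (t • D k + u • E k) ^ 2 =
      t ^ 2 * ∑ k, fnorm (D k) ^ 2 + 2 * t * u * ∑ k, finner (D k) (E k)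
        + u ^ 2 * ∑ k, fnorm (E k) ^ 2 := by
    intro t u
    simp only [Finset.mul_sum, ← Finset.sum_add_distrib]
    refine Finset.sum_congr rfl fun k _ => ?_
    simp only [fnorm_sq, finner_add_left', finner_add_right', finner_smul_left',
      finner_smul_right', finner_comm' (E k) (D k)]
    ring
  have key2 : ∀ t u : ℝ, enorm2 (∑ k, opA (A k) (t • D k + u • E k)) ^ 2 =
      t ^ 2 * ((∑ k, opA (A k) (D k)) ⬝ᵥ (∑ k, opA (A k) (D k)))
      + 2 * t * u * ((∑ k, opA (A k) (D k)) ⬝ᵥ (∑ k, opA (A k) (E k)))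
        + u ^ 2 * ((∑ k, opA (A k) (E k)) ⬝ᵥ (∑ k, opA (A k) (E k))) := by
    intro t u
    simp only [opA_add, opA_smul, Finset.sum_add_distrib, ← Finset.smul_sum, enorm2_sq]
    simp only [add_dotProduct, dotProduct_add, smul_dotProduct, dotProduct_smul, smul_eq_mul,
      dotProduct_comm (∑ k, opA (A k) (E k)) (∑ k, opA (A k) (D k))]
    ring
  have h1 := (h (fun k => t • D k + (1 : ℝ) • E k) (hr t 1)).1
  have h2 := (h (fun k => t • D k + (-1 : ℝ) • E k) (hr t (-1))).2
  simp only [key, key2] at h1 h2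
  linarith

end helpers

/-- **One step of IHT contracts** (Theorem 2, noiseless case). -/
theorem iht_one_step
    {n m r s : ℕ}
    (A : Fin s → Fin m → Matrix (Fin n) (Fin n) ℝ)
    (δ₃ : ℝ) (hδ₃ : δ₃ < 1)
    (hARIP : ARIP (fun k => opA (A k)) (3 * r) δ₃)
    (hγ : 4 * δ₃ / (1 - δ₃) < 1)
    (X Xl Xnext : Fin s → Matrix (Fin n) (Fin n) ℝ)
    (hX : ∀ k, (X k).rank ≤ r)
    (U V : Fin s → Matrix (Fin n) (Fin r) ℝ)
    (S : Fin s → Matrix (Fin r) (Fin r) ℝ)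
    (hU : ∀ k, (U k)ᵀ * U k = 1) (hV : ∀ k, (V k)ᵀ * V k = 1)
    (hSdiag : ∀ k i j, i ≠ j → S k i j = 0) (hSpos : ∀ k i, 0 < S k i i)
    (hXl : ∀ k, Xl k = U k * S k * (V k)ᵀ)
    (y : Fin m → ℝ) (hy : y = ∑ k, opA (A k) (X k))
    (G : Fin s → Matrix (Fin n) (Fin n) ℝ)
    (hG : ∀ k, G k = adjA (A k) (y - ∑ j, opA (A j) (Xl j)))
    (hPt : ∀ k, Pt (U k) (V k) (G k) ≠ 0)
    (α : Fin s → ℝ)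
    (hα : ∀ k, α k = fnorm (Pt (U k) (V k) (G k)) ^ 2 /
        enorm2 (opA (A k) (Pt (U k) (V k) (G k))) ^ 2)
    (hNext : ∀ k, IsBestRankApprox r (Xl k + α k • G k) (Xnext k)) :
    Real.sqrt (∑ k, fnorm (Xnext k - X k) ^ 2) ≤
      (4 * δ₃ / (1 - δ₃)) * Real.sqrt (∑ k, fnorm (Xl k - X k) ^ 2) := by
  by_cases hs : s = 0
  · subst hs; simp
  have hk0 : ∃ k : Fin s, True := ⟨⟨0, Nat.pos_of_ne_zero hs⟩, trivial⟩
  have hd : 0 < 1 - δ₃ := by linarith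
  have hδ : 0 ≤ δ₃ := by
    obtain ⟨k, -⟩ := hk0
    have h := arip_single A δ₃ hARIP k _ (rank_Pt (U k) (V k) (G k))
    have hp := finner_self_pos _ (hPt k)
    rw [← fnorm_sq] at hp
    by_contra hneg
    push Not at hneg
    nlinarith [h.1, h.2]
  have hc : 0 ≤ δ₃ / (1 - δ₃) := by positivity
  have hαb : ∀ k, 0 ≤ α k ∧ α k ≤ 1 / (1 - δ₃) ∧ |1 - α k| ≤ δ₃ / (1 - δ₃) := by
    intro k
    have h := arip_single A δ₃ hARIP k _ (rank_Pt (U k) (V k) (G k))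
    have hp := finner_self_pos _ (hPt k)
    rw [← fnorm_sq] at hp
    rw [hα k]
    generalize fnorm (Pt (U k) (V k) (G k)) ^ 2 = a at *
    generalize enorm2 (opA (A k) (Pt (U k) (V k) (G k))) ^ 2 = b at *
    have hb : 0 < b := lt_of_lt_of_le (by positivity) h.1
    have h1 : a / b ≤ 1 / (1 - δ₃) := by
      rw [div_le_div_iff₀ hb hd]; linarith [h.1]
    have e : δ₃ / (1 - δ₃) = 1 / (1 - δ₃) - 1 := by field_simp; ring
    refine ⟨by positivity, h1, abs_le.2 ⟨by linarith, ?_⟩⟩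
    have h2 : 1 - δ₃ ≤ a / b := by
      rw [le_div_iff₀ hb]; nlinarith [h.2, sq_nonneg δ₃]
    have h3 : δ₃ ≤ δ₃ / (1 - δ₃) := by
      rw [le_div_iff₀ hd]; nlinarith
    linarith
  set D : Fin s → Matrix (Fin n) (Fin n) ℝ := fun k => Xnext k - X k with hDdef
  set E : Fin s → Matrix (Fin n) (Fin n) ℝ := fun k => Xl k - X k with hEdef
  have hXlr : ∀ k, (Xl k).rank ≤ r := by
    intro k
    rw [hXl k]
    exact (Matrix.rank_mul_le_right _ _).trans ((Matrix.rank_le_card_height _).trans (by simp))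
  have hres : y - ∑ j, opA (A j) (Xl j) = (-1 : ℝ) • ∑ j, opA (A j) (E j) := by
    rw [hy, Finset.smul_sum, ← Finset.sum_sub_distrib]
    refine Finset.sum_congr rfl fun j _ => ?_
    have : E j = Xl j + (-1 : ℝ) • X j := by simp [hEdef, sub_eq_add_neg]
    rw [this, opA_add, opA_smul]
    ext p; simp; ring
  have hGD : ∀ k, finner (D k) (G k) = - (opA (A k) (D k) ⬝ᵥ ∑ j, opA (A j) (E j)) := by
    intro k
    rw [hG k, finner_adjA, hres, dotProduct_smul]; simp
  have hopt : ∀ k, fnorm (D k) ^ 2 ≤ 2 * (finner (D k) (E k) + α k * finner (D k) (G k)) := by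
    intro k
    have h := (hNext k).2 (X k) (hX k)
    have h0 : 0 ≤ fnorm (Xnext k - (Xl k + α k • G k)) := Real.sqrt_nonneg _
    have h' := pow_le_pow_left₀ h0 h 2
    rw [fnorm_sq, fnorm_sq] at h'
    have e1 : Xnext k - (Xl k + α k • G k) = D k + (-1 : ℝ) • (E k + α k • G k) := by
      simp only [hDdef, hEdef, neg_smul, one_smul]; abel
    have e2 : X k - (Xl k + α k • G k) = (-1 : ℝ) • (E k + α k • G k) := by
      simp only [hEdef, neg_smul, one_smul]; abel
    rw [e1, e2] at h'
    have e3 : finner (D k) (E k) + α k * finner (D k) (G k) = finner (D k) (E k + α k • G k) := by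
      rw [finner_add_right', finner_smul_right']
    rw [e3, fnorm_sq]
    generalize E k + α k • G k = W at *
    simp only [finner_add_left', finner_add_right', finner_smul_left',
      finner_smul_right', finner_comm' W (D k)] at h'
    linarith
  have hrank : ∀ (t u : ℝ) k, (t • (α k • D k) + u • E k).rank ≤ 3 * r := by
    intro t u k
    have e : t • (α k • D k) + u • E k =
        (t * α k) • Xnext k + (-(t * α k) - u) • X k + u • Xl k := by
      simp only [hDdef, hEdef, smul_sub, sub_smul, neg_smul, smul_smul]; abel
    rw [e]
    have h1 := mrank_add_le ((t * α k) • Xnext k + (-(t * α k) - u) • X k) (u • Xl k)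
    have h2 := mrank_add_le ((t * α k) • Xnext k) ((-(t * α k) - u) • X k)
    have h3 := rank_smul_le' (t * α k) (Xnext k)
    have h4 := rank_smul_le' (-(t * α k) - u) (X k)
    have h5 := rank_smul_le' u (Xl k)
    have h6 := (hNext k).1
    have h7 := hX k
    have h8 := hXlr k
    omega
  have hpol := arip_polar A δ₃ hδ hARIP (fun k => α k • D k) E hrank
  change √(∑ k, fnorm (D k) ^ 2) ≤ 4 * δ₃ / (1 - δ₃) * √(∑ k, fnorm (E k) ^ 2)
  have hDn : 0 ≤ ∑ k, fnorm (D k) ^ 2 := Finset.sum_nonneg fun _ _ => sq_nonneg _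
  have hN' : √(∑ k, fnorm (α k • D k) ^ 2) ≤ 1 / (1 - δ₃) * √(∑ k, fnorm (D k) ^ 2) := by
    apply Real.sqrt_le_iff.2 ⟨by positivity, ?_⟩
    rw [mul_pow, Real.sq_sqrt hDn, Finset.mul_sum]
    refine Finset.sum_le_sum fun k _ => ?_
    have : fnorm (α k • D k) ^ 2 = α k ^ 2 * fnorm (D k) ^ 2 := by
      simp only [fnorm_sq, finner_smul_left', finner_smul_right']; ring
    rw [this]
    have := pow_le_pow_left₀ (hαb k).1 (hαb k).2.1 2
    gcongr
  have hcs : ∑ k, (1 - α k) * finner (D k) (E k) ≤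
      δ₃ / (1 - δ₃) * (√(∑ k, fnorm (D k) ^ 2) * √(∑ k, fnorm (E k) ^ 2)) := by
    calc _ ≤ ∑ k, δ₃ / (1 - δ₃) * (fnorm (D k) * fnorm (E k)) := by
          refine Finset.sum_le_sum fun k _ => ?_
          refine (le_abs_self _).trans ?_
          rw [abs_mul]
          exact mul_le_mul (hαb k).2.2 (finner_cs _ _) (abs_nonneg _) hc
      _ = δ₃ / (1 - δ₃) * ∑ k, (fnorm (D k) * fnorm (E k)) := by rw [Finset.mul_sum]
      _ ≤ _ := by
          gcongr
          exact Real.sum_mul_le_sqrt_mul_sqrt _ _ _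
  have hsum := Finset.sum_le_sum fun k (_ : k ∈ Finset.univ) => hopt k
  have hsplit : ∑ k, 2 * (finner (D k) (E k) + α k * finner (D k) (G k)) =
      2 * (∑ k, (1 - α k) * finner (D k) (E k) + (∑ k, finner (α k • D k) (E k) -
        (∑ k, opA (A k) (α k • D k)) ⬝ᵥ (∑ k, opA (A k) (E k)))) := by
    rw [sum_dotProduct, ← Finset.sum_sub_distrib, ← Finset.sum_add_distrib, Finset.mul_sum]
    refine Finset.sum_congr rfl fun k _ => ?_
    rw [hGD, finner_smul_left', opA_smul, smul_dotProduct, smul_eq_mul]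
    ring
  rw [hsplit] at hsum
  have hq := (le_abs_self _).trans hpol
  have hsq := Real.sq_sqrt hDn
  rw [← hsq] at hsum
  have ha := Real.sqrt_nonneg (∑ k, fnorm (D k) ^ 2)
  have hb := Real.sqrt_nonneg (∑ k, fnorm (E k) ^ 2)
  generalize √(∑ k, fnorm (D k) ^ 2) = a at *
  generalize √(∑ k, fnorm (E k) ^ 2) = b at *
  have h5 : δ₃ * (√(∑ k, fnorm (α k • D k) ^ 2) * b) ≤ δ₃ / (1 - δ₃) * (a * b) := by
    calc _ ≤ δ₃ * (1 / (1 - δ₃) * a * b) := by gcongr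
      _ = _ := by ring
  have h6 : a ^ 2 ≤ (4 * δ₃ / (1 - δ₃) * b) * a := by
    have : (4 * δ₃ / (1 - δ₃) * b) * a = 4 * (δ₃ / (1 - δ₃) * (a * b)) := by ring
    rw [this]
    linarith
  rcases ha.eq_or_lt with h0 | h0
  · rw [← h0]; positivity
  · rw [sq] at h6
    exact le_of_mul_le_mul_right h6 h0
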